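/- Let n ≥ 3, u : ℝⁿ → ℝ a twice continuously differentiable solution of -Δu = γ|u|^{p-1}u with p = (n+2)/(n-2), γ = n(n-2)/4, and fix α ∈ {1,…,n}. Define z(y) := -2y_α[((n-2)/2)u(y) + ∇u(y)·y] + |y|² ∂_{y_α}u(y). Then z solves the linearized equation Δz + pγ|u|^{p-1}z = 0 on ℝⁿ. -/

import Mathlib

open Real

/-- The Euclidean Laplacian of `u : ℝⁿ → ℝ`, as the sum of second partial derivatives. -/
noncomputable def lap {n : ℕ} (u : EuclideanSpace ℝ (Fin n) → ℝ)
    (y : EuclideanSpace ℝ (Fin n)) : ℝ :=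
  ∑ i, fderiv ℝ (fun z => fderiv ℝ u z (EuclideanSpace.single i 1)) y
    (EuclideanSpace.single i 1)

section DirectionalDerivative

open scoped ContDiff

variable {E : Type*} [NormedAddCommGroup E] [NormedSpace ℝ E]

/-- The derivative of `f` in the fixed direction `v`, as a function of the base point. -/
noncomputable def dirDeriv (v : E) (f : E → ℝ) : E → ℝ := fun x => fderiv ℝ f x v

theorem ContDiff.dirDeriv {f : E → ℝ} {m k : ℕ∞} (hf : ContDiff ℝ k f) (h : m + 1 ≤ k) (v : E) :
    ContDiff ℝ m (dirDeriv v f) :=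
  (hf.fderiv_right (by exact_mod_cast h)).clm_apply contDiff_const

theorem HasCompactSupport.dirDeriv {f : E → ℝ} (hf : HasCompactSupport f) (v : E) :
    HasCompactSupport (dirDeriv v f) :=
  hf.fderiv_apply ℝ v

theorem dirDeriv_comm_of_differentiable {f : E → ℝ} (hf : Differentiable ℝ f)
    (hf' : Differentiable ℝ (fderiv ℝ f)) (v w : E) :
    dirDeriv v (dirDeriv w f) = dirDeriv w (dirDeriv v f) := by
  have key : ∀ x a b : E, _root_.dirDeriv a (_root_.dirDeriv b f) x
      = fderiv ℝ (fderiv ℝ f) x a b := fun x a b => by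
    have := ((hf' x).hasFDerivAt.clm_apply (hasFDerivAt_const b x)).fderiv
    change fderiv ℝ (fun y => fderiv ℝ f y b) x a = _
    rw [this]
    simp
  ext x
  rw [key, key]
  exact second_derivative_symmetric (fun y => (hf y).hasFDerivAt) (hf' x).hasFDerivAt v w

theorem dirDeriv_comm {f : E → ℝ} (hf : ContDiff ℝ 2 f) (v w : E) :
    dirDeriv v (dirDeriv w f) = dirDeriv w (dirDeriv v f) :=
  dirDeriv_comm_of_differentiable (hf.differentiable (by norm_num))
    ((hf.fderiv_right (m := 1) (by norm_num)).differentiable (by norm_num)) v w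

theorem dirDeriv_comp_add_smul {w : E → ℝ} (hw : Differentiable ℝ w) (x v : E) (r : ℝ) (y : E) :
    dirDeriv v (fun y => w (x + r • y)) y = r * dirDeriv v w (x + r • y) := by
  have h : HasFDerivAt (fun y : E => x + r • y) (r • ContinuousLinearMap.id ℝ E) y :=
    ((hasFDerivAt_id y).const_smul r).const_add x
  have := ((hw (x + r • y)).hasFDerivAt.comp y h).fderiv
  simp only [dirDeriv]
  rw [show (fun y => w (x + r • y)) = w ∘ fun y => x + r • y from rfl, this]
  simp

end DirectionalDerivative

section DilatedAverage

open MeasureTheory Metric Filter Topology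
open scoped ContDiff

variable {E : Type*} [NormedAddCommGroup E] [InnerProductSpace ℝ E] [FiniteDimensional ℝ E]
  [MeasurableSpace E] [BorelSpace E]
variable {G : Type*} [NormedAddCommGroup G] [NormedSpace ℝ G]

/-- The average of `w` around `x` at scale `r`, weighted by `ψ`. -/
noncomputable def dilAvg (ψ : E → ℝ) (w : E → G) (r : ℝ) (x : E) : G :=
  ∫ y, ψ y • w (x + r • y)

theorem integrable_dilAvg {ψ : E → ℝ} {w : E → G} (hψ : Continuous ψ) (hc : HasCompactSupport ψ)
    (hw : Continuous w) (r : ℝ) (x : E) : Integrable fun y => ψ y • w (x + r • y) :=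
  Continuous.integrable_of_hasCompactSupport (by fun_prop) hc.smul_right

/-- Moving one derivative from the weight to the function gains a factor `-r`. -/
theorem dilAvg_dirDeriv_left {ψ w : E → ℝ} (hψ : ContDiff ℝ 1 ψ) (hc : HasCompactSupport ψ)
    (hw : ContDiff ℝ 1 w) (v : E) (r : ℝ) (x : E) :
    dilAvg (dirDeriv v ψ) w r x = -r * dilAvg ψ (dirDeriv v w) r x := by
  have hψ' : Continuous (dirDeriv v ψ) := (hψ.dirDeriv (m := 0) (k := 1) (by simp) v).continuous
  have hw' : Continuous (dirDeriv v w) := (hw.dirDeriv (m := 0) (k := 1) (by simp) v).continuous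
  have hwd := hw.differentiable one_ne_zero
  have hfd : ∀ y, fderiv ℝ (fun y => w (x + r • y)) y v = r * dirDeriv v w (x + r • y) :=
    fun y => dirDeriv_comp_add_smul hwd x v r y
  have h := integral_mul_fderiv_eq_neg_fderiv_mul_of_integrable (μ := volume) (f := ψ)
    (g := fun y => w (x + r • y)) (v := v)
    (integrable_dilAvg hψ' (hc.dirDeriv v) hw.continuous r x)
    (by
      simp only [hfd]
      refine ((integrable_dilAvg hψ.continuous hc hw' r x).const_mul r).congr (ae_of_all _ ?_)
      intro y; simp only [smul_eq_mul]; ring)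
    (integrable_dilAvg hψ.continuous hc hw.continuous r x)
    (fun y _ => hψ.differentiable one_ne_zero y)
    (fun y _ => by fun_prop)
  simp only [hfd] at h
  simp only [dilAvg, smul_eq_mul]
  rw [← integral_const_mul]
  calc _ = -∫ y, ψ y * (r * dirDeriv v w (x + r • y)) := by rw [h, neg_neg]; rfl
    _ = _ := by rw [← integral_neg]; congr 1; ext y; ring

theorem dilAvg_dirDeriv_dirDeriv_left {ψ w : E → ℝ} (hψ : ContDiff ℝ 2 ψ)
    (hc : HasCompactSupport ψ) (hw : ContDiff ℝ 2 w) (a b : E) (r : ℝ) (x : E) :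
    dilAvg (dirDeriv a (dirDeriv b ψ)) w r x
      = r ^ 2 * dilAvg ψ (dirDeriv a (dirDeriv b w)) r x := by
  have hle : (1 : ℕ∞) + 1 ≤ 2 := by norm_num
  rw [dilAvg_dirDeriv_left (hψ.dirDeriv (k := 2) hle b) (hc.dirDeriv b)
      (hw.of_le (by norm_num)) a,
    dilAvg_dirDeriv_left (hψ.of_le (by norm_num)) hc (hw.dirDeriv (k := 2) hle a) b,
    dirDeriv_comm hw]
  ring

theorem hasFDerivAt_dilAvg {ψ w : E → ℝ} (hψ : Continuous ψ) (hc : HasCompactSupport ψ)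
    (hw : ContDiff ℝ 1 w) (r : ℝ) (x : E) :
    HasFDerivAt (dilAvg ψ w r) (dilAvg ψ (fderiv ℝ w) r x) x := by
  have hw' : Continuous (fderiv ℝ w) := hw.continuous_fderiv one_ne_zero
  have hcomp : IsCompact ((fun p : E × E => p.1 + r • p.2) '' (closedBall x 1 ×ˢ tsupport ψ)) :=
    ((isCompact_closedBall x 1).prod hc).image (by fun_prop)
  obtain ⟨M, hM⟩ := hcomp.exists_bound_of_continuousOn hw'.continuousOn
  refine hasFDerivAt_integral_of_dominated_of_fderiv_le (bound := fun y => ‖ψ y‖ * M)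
    (F' := fun z y => ψ y • fderiv ℝ w (z + r • y))
    (closedBall_mem_nhds x one_pos) (Eventually.of_forall fun z => ?_)
    (integrable_dilAvg hψ hc hw.continuous r x)
    (integrable_dilAvg hψ hc hw' r x).aestronglyMeasurable
    (ae_of_all _ fun y z hz => ?_) ?_ (ae_of_all _ fun y z _ => ?_)
  · exact (integrable_dilAvg hψ hc hw.continuous r z).aestronglyMeasurable
  · by_cases hy : ψ y = 0
    · simp [hy]
    · rw [norm_smul]
      exact mul_le_mul_of_nonneg_left
        (hM _ ⟨(z, y), ⟨hz, subset_tsupport _ hy⟩, rfl⟩) (norm_nonneg _)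
  · exact (hψ.integrable_of_hasCompactSupport hc).norm.mul_const M
  · have h : HasFDerivAt (fun z : E => z + r • y) (ContinuousLinearMap.id ℝ E) z :=
      (hasFDerivAt_id z).add_const _
    have := ((hw.differentiable one_ne_zero (z + r • y)).hasFDerivAt.comp z h).const_smul (ψ y)
    simpa using! this

theorem tendsto_dilAvg {ψ w : E → ℝ} (hψ : Continuous ψ) (hc : HasCompactSupport ψ)
    (hw : Continuous w) (x : E) :
    Tendsto (fun r => dilAvg ψ w r x) (𝓝 0) (𝓝 ((∫ y, ψ y) * w x)) := by
  have hcont : Continuous fun r : ℝ => ∫ y in tsupport ψ, ψ y • w (x + r • y) :=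
    continuous_parametric_integral_of_continuous (by fun_prop) hc
  have heq : ∀ r, ∫ y in tsupport ψ, ψ y • w (x + r • y) = dilAvg ψ w r x := fun r =>
    setIntegral_eq_integral_of_forall_compl_eq_zero fun y hy => by
      rw [image_eq_zero_of_notMem_tsupport hy, zero_smul]
  simp only [heq] at hcont
  have := hcont.tendsto 0
  simpa [dilAvg, integral_mul_const] using this

theorem differentiable_dilAvg_one {ψ w : E → ℝ} (hψ : ContDiff ℝ 1 ψ) (hc : HasCompactSupport ψ)
    (hw : Continuous w) : Differentiable ℝ (dilAvg ψ w 1) := by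
  have hsupp : HasCompactSupport (ψ ∘ Neg.neg) := hc.comp_homeomorph (Homeomorph.neg E)
  have h := hsupp.contDiff_convolution_left (n := 1) (ContinuousLinearMap.lsmul ℝ ℝ)
    (μ := volume) (hψ.comp contDiff_neg) (hw.locallyIntegrable (μ := volume))
  have heq : dilAvg ψ w 1 = convolution (ψ ∘ Neg.neg) w (ContinuousLinearMap.lsmul ℝ ℝ) volume := by
    ext x
    simp only [dilAvg, convolution]
    rw [← integral_neg_eq_self]
    simp [sub_eq_add_neg]
  rw [heq]
  exact h.differentiable one_ne_zero

/-- Local Hölder continuity: on every ball centred at the origin, with exponent `β`. -/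
def LocHolder (β : ℝ) (F : E → G) : Prop :=
  ∀ R : ℝ, ∃ C : ℝ, ∀ x ∈ closedBall (0 : E) R, ∀ y ∈ closedBall (0 : E) R,
    ‖F x - F y‖ ≤ C * ‖x - y‖ ^ β

/-- Averages of a Hölder function against a mean-zero weight decay like the scale to the power of
the Hölder exponent. -/
theorem exists_norm_dilAvg_le [CompleteSpace G] {ψ : E → ℝ} {F : E → G} {β : ℝ} (hβ : 0 ≤ β)
    (hψ : Continuous ψ) (hc : HasCompactSupport ψ) (hmean : ∫ y, ψ y = 0) (hF : Continuous F)
    (hH : LocHolder β F) (R : ℝ) :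
    ∃ C, ∀ r, 0 ≤ r → r ≤ 1 → ∀ x ∈ closedBall (0 : E) R, ‖dilAvg ψ F r x‖ ≤ C * r ^ β := by
  obtain ⟨ρ, hρ0, hρ⟩ : ∃ ρ, 0 ≤ ρ ∧ ∀ y, ψ y ≠ 0 → ‖y‖ ≤ ρ := by
    obtain ⟨ρ, hρ⟩ := hc.isBounded.subset_closedBall (0 : E)
    refine ⟨max ρ 0, le_max_right _ _, fun y hy => le_max_of_le_left ?_⟩
    simpa using hρ (subset_tsupport _ hy)
  obtain ⟨C, hC⟩ := hH (R + ρ)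
  refine ⟨(∫ y, ‖ψ y‖) * (|C| * ρ ^ β), fun r hr0 hr1 x hx => ?_⟩
  have hx' : ‖x‖ ≤ R := by simpa using hx
  have hsub : dilAvg ψ F r x = ∫ y, ψ y • (F (x + r • y) - F x) := by
    simp only [smul_sub]
    rw [integral_sub (integrable_dilAvg hψ hc hF r x)
      ((hψ.integrable_of_hasCompactSupport hc).smul_const _), integral_smul_const, hmean, zero_smul,
      sub_zero, dilAvg]
  rw [hsub, mul_assoc, ← integral_mul_const]
  refine norm_integral_le_of_norm_le
    ((hψ.integrable_of_hasCompactSupport hc).norm.mul_const _) (ae_of_all _ fun y => ?_)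
  rw [norm_smul]
  by_cases hy : ψ y = 0
  · simp [hy]
  refine mul_le_mul_of_nonneg_left ?_ (norm_nonneg _)
  have hry : ‖r • y‖ ≤ r * ρ := by
    rw [norm_smul, Real.norm_of_nonneg hr0]
    exact mul_le_mul_of_nonneg_left (hρ y hy) hr0
  have hry' : r * ρ ≤ ρ := mul_le_of_le_one_left hρ0 hr1
  calc ‖F (x + r • y) - F x‖ ≤ C * ‖x + r • y - x‖ ^ β := by
        refine hC _ ?_ _ ?_ <;> rw [mem_closedBall_zero_iff]
        · exact (norm_add_le _ _).trans (by linarith)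
        · linarith
    _ ≤ |C| * ‖r • y‖ ^ β := by
        rw [add_sub_cancel_left]
        exact mul_le_mul_of_nonneg_right (le_abs_self C) (by positivity)
    _ ≤ |C| * (r * ρ) ^ β := by gcongr
    _ = |C| * ρ ^ β * r ^ β := by rw [Real.mul_rpow hr0 hρ0]; ring

/-- If the dyadic increments of the averages of a continuous function `w` are mean-zero averages of
a function with locally Hölder gradient, then `w` is differentiable. -/
theorem differentiable_of_dilAvg_sub {φ θ w f : E → ℝ} {β : ℝ} (hβ : 0 < β)
    (hφ : ContDiff ℝ 1 φ) (hφc : HasCompactSupport φ) (hφ0 : ∫ y, φ y ≠ 0)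
    (hθ : Continuous θ) (hθc : HasCompactSupport θ) (hθ0 : ∫ y, θ y = 0)
    (hw : Continuous w) (hf : ContDiff ℝ 1 f) (hfH : LocHolder β f)
    (hf'H : LocHolder β (fderiv ℝ f))
    (hsub : ∀ r : ℝ, 0 < r → ∀ x, dilAvg φ w (r / 2) x - dilAvg φ w r x = dilAvg θ f r x) :
    Differentiable ℝ w := by
  set r : ℕ → ℝ := fun k => (1 / 2) ^ k with hr
  have hr0 : ∀ k, 0 < r k := fun k => by positivity
  have hr1 : ∀ k, r k ≤ 1 := fun k => pow_le_one₀ (by norm_num) (by norm_num)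
  have hrsum : Summable fun k => r k ^ β := by
    have : ∀ k, r k ^ β = ((1 / 2 : ℝ) ^ β) ^ k := fun k => by
      change ((1 / 2 : ℝ) ^ k) ^ β = _
      rw [← Real.rpow_natCast, ← Real.rpow_natCast, ← Real.rpow_mul (by norm_num),
        ← Real.rpow_mul (by norm_num), mul_comm]
    simp only [this]
    exact summable_geometric_of_lt_one (by positivity)
      (Real.rpow_lt_one (by norm_num) (by norm_num) hβ)
  have hsummable : ∀ x, Summable fun k => dilAvg θ f (r k) x := fun x => by
    obtain ⟨C, hC⟩ := exists_norm_dilAvg_le hβ.le hθ hθc hθ0 hf.continuous hfH ‖x‖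
    exact Summable.of_norm_bounded (hrsum.mul_left C)
      fun k => hC (r k) (hr0 k).le (hr1 k) x (by simp)
  have htsum : ∀ x, ∑' k, dilAvg θ f (r k) x = (∫ y, φ y) * w x - dilAvg φ w 1 x := fun x => by
    have hpart : ∀ K, ∑ k ∈ Finset.range K, dilAvg θ f (r k) x
        = dilAvg φ w (r K) x - dilAvg φ w 1 x := fun K => by
      have := Finset.sum_range_sub (fun k => dilAvg φ w (r k) x) K
      simp only [hr, pow_zero] at this ⊢
      rw [← this]
      refine Finset.sum_congr rfl fun k _ => ?_
      rw [← hsub _ (by positivity)]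
      congr 2
      ring
    have hrlim : Tendsto r atTop (𝓝 0) :=
      tendsto_pow_atTop_nhds_zero_of_lt_one (by norm_num) (by norm_num)
    refine ((hsummable x).hasSum_iff_tendsto_nat.2 ?_).tsum_eq
    simp only [hpart]
    exact ((tendsto_dilAvg hφ.continuous hφc hw x).comp hrlim).sub_const _
  have hw_eq : w = fun x => (∫ y, φ y)⁻¹ * (∑' k, dilAvg θ f (r k) x + dilAvg φ w 1 x) := by
    ext x
    rw [htsum, sub_add_cancel, inv_mul_cancel_left₀ hφ0]
  have hdiff : Differentiable ℝ fun x => ∑' k, dilAvg θ f (r k) x := fun x => by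
    obtain ⟨C, hC⟩ := exists_norm_dilAvg_le hβ.le hθ hθc hθ0
      (hf.continuous_fderiv one_ne_zero) hf'H (‖x‖ + 1)
    have hx : x ∈ ball (0 : E) (‖x‖ + 1) := by simp
    exact (hasFDerivAt_tsum_of_isPreconnected (hrsum.mul_left C) isOpen_ball
      (convex_ball (0 : E) (‖x‖ + 1)).isPreconnected
      (fun k z _ => hasFDerivAt_dilAvg hθ hθc hf (r k) z)
      (fun k z hz => hC (r k) (hr0 k).le (hr1 k) z (ball_subset_closedBall hz))
      hx (hsummable x) hx).differentiableAt
  rw [hw_eq]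
  exact (hdiff.add (differentiable_dilAvg_one hφ hφc hw)).const_mul _

end DilatedAverage

section Kernel

open MeasureTheory Metric Filter Topology
open scoped ContDiff

variable {n : ℕ}

theorem lap_eq_sum_dirDeriv (u : EuclideanSpace ℝ (Fin n) → ℝ) (y : EuclideanSpace ℝ (Fin n)) :
    lap u y = ∑ i, dirDeriv (EuclideanSpace.single i 1) (dirDeriv (EuclideanSpace.single i 1) u) y :=
  rfl

theorem dirDeriv_comp_norm_sq {g : ℝ → ℝ} (hg : Differentiable ℝ g)
    (v : EuclideanSpace ℝ (Fin n)) (y : EuclideanSpace ℝ (Fin n)) :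
    dirDeriv v (fun y => g (‖y‖ ^ 2)) y = 2 * inner ℝ y v * deriv g (‖y‖ ^ 2) := by
  have h := ((hg (‖y‖ ^ 2)).hasDerivAt.hasFDerivAt.comp y
    (hasStrictFDerivAt_norm_sq y).hasFDerivAt).fderiv
  change fderiv ℝ (g ∘ fun y => ‖y‖ ^ 2) y v = _
  rw [h]
  simp
  ring

theorem lap_comp_norm_sq {g : ℝ → ℝ} (hg : ContDiff ℝ ∞ g) (y : EuclideanSpace ℝ (Fin n)) :
    lap (fun y => g (‖y‖ ^ 2)) y
      = 2 * n * deriv g (‖y‖ ^ 2) + 4 * ‖y‖ ^ 2 * deriv (deriv g) (‖y‖ ^ 2) := by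
  have hg' : ContDiff ℝ ∞ (deriv g) := (contDiff_infty_iff_deriv.1 hg).2
  have hterm : ∀ i : Fin n, dirDeriv (EuclideanSpace.single i 1)
      (dirDeriv (EuclideanSpace.single i 1) fun y => g (‖y‖ ^ 2)) y
      = 2 * deriv g (‖y‖ ^ 2) + 4 * deriv (deriv g) (‖y‖ ^ 2) * y i ^ 2 := fun i => by
    have hfun : dirDeriv (EuclideanSpace.single i 1) (fun y => g (‖y‖ ^ 2))
        = fun y : EuclideanSpace ℝ (Fin n) => (2 * y i) * deriv g (‖y‖ ^ 2) := by
      ext y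
      rw [dirDeriv_comp_norm_sq (hg.differentiable (by simp))]
      simp [EuclideanSpace.inner_single_right]
    have hd : Differentiable ℝ fun y : EuclideanSpace ℝ (Fin n) => deriv g (‖y‖ ^ 2) :=
      (hg'.differentiable (by simp)).comp ((contDiff_norm_sq ℝ (n := 1)).differentiable (by simp))
    have hp : HasFDerivAt (fun y : EuclideanSpace ℝ (Fin n) => 2 * y i)
        ((2 : ℝ) • (EuclideanSpace.proj i : EuclideanSpace ℝ (Fin n) →L[ℝ] ℝ)) y :=
      (EuclideanSpace.proj i : EuclideanSpace ℝ (Fin n) →L[ℝ] ℝ).hasFDerivAt.const_mul 2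
    have h2 := dirDeriv_comp_norm_sq (hg'.differentiable (by simp))
      (EuclideanSpace.single i (1 : ℝ)) y
    rw [hfun]
    simp only [dirDeriv] at h2 ⊢
    rw [(hp.fun_mul (hd y).hasFDerivAt).fderiv]
    simp [h2, EuclideanSpace.inner_single_right]
    ring
  rw [lap_eq_sum_dirDeriv, Finset.sum_congr rfl fun i _ => hterm i, Finset.sum_add_distrib,
    ← Finset.mul_sum Finset.univ fun i => y i ^ 2, ← EuclideanSpace.real_norm_sq_eq]
  simp
  ring

theorem lap_comp_smul {N : EuclideanSpace ℝ (Fin n) → ℝ} (hN : ContDiff ℝ 2 N) (r : ℝ)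
    (y : EuclideanSpace ℝ (Fin n)) : lap (fun y => N (r • y)) y = r ^ 2 * lap N (r • y) := by
  have key : ∀ {w : EuclideanSpace ℝ (Fin n) → ℝ}, Differentiable ℝ w → ∀ v,
      dirDeriv v (fun y => w (r • y)) = fun y => r * dirDeriv v w (r • y) := fun hw v => by
    ext y
    simpa using dirDeriv_comp_add_smul hw 0 v r y
  rw [lap_eq_sum_dirDeriv, lap_eq_sum_dirDeriv, Finset.mul_sum]
  refine Finset.sum_congr rfl fun i _ => ?_
  have hd : Differentiable ℝ (dirDeriv (EuclideanSpace.single i 1) N) :=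
    (hN.dirDeriv (m := 1) (k := 2) (by norm_num) _).differentiable (by norm_num)
  have hc : Differentiable ℝ fun y => dirDeriv (EuclideanSpace.single i 1) N (r • y) := by fun_prop
  rw [key (hN.differentiable (by norm_num))]
  have := congrFun (key hd (EuclideanSpace.single i 1)) y
  simp only [dirDeriv] at this hc ⊢
  rw [fderiv_const_mul (hc y)]
  simp only [smul_apply, this, smul_eq_mul]
  ring

theorem exists_contDiff_eq_rpow (m : ℝ) :
    ∃ η : ℝ → ℝ, ContDiff ℝ ∞ η ∧ ∀ s, 1 ≤ s → η s = s ^ (-m) := by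
  refine ⟨fun s => Real.smoothTransition (2 * s - 1) * s ^ (-m), ?_, fun s hs => ?_⟩
  · rw [contDiff_iff_contDiffAt]
    intro s
    rcases lt_or_ge s (1 / 2) with hs | hs
    · refine (contDiffAt_const (c := (0 : ℝ))).congr_of_eventuallyEq ?_
      filter_upwards [gt_mem_nhds hs] with t ht
      rw [Real.smoothTransition.zero_of_nonpos (by linarith), zero_mul]
    · refine ContDiffAt.mul ?_ (Real.contDiffAt_rpow_const_of_ne (by linarith))
      exact Real.smoothTransition.contDiff.contDiffAt.comp s (by fun_prop)
  · simp [Real.smoothTransition.one_of_one_le (x := 2 * s - 1) (by linarith)]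

/-- A radial smoothing of the fundamental solution of the Laplacian: its Laplacian is a compactly
supported function of nonzero integral. -/
theorem exists_smoothed_fundamental_solution (hn : 3 ≤ n) :
    ∃ N : EuclideanSpace ℝ (Fin n) → ℝ, ContDiff ℝ ∞ N ∧
      (∀ y, 1 ≤ ‖y‖ → N y = (‖y‖ ^ 2) ^ (-(((n : ℝ) - 2) / 2))) ∧
      HasCompactSupport (lap N) ∧ ∫ y, lap N y ≠ 0 := by
  obtain ⟨η, hη, hη1⟩ := exists_contDiff_eq_rpow (((n : ℝ) - 2) / 2)
  have hη' : ContDiff ℝ ∞ (deriv η) := (contDiff_infty_iff_deriv.1 hη).2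
  have hn' : (3 : ℝ) ≤ n := by exact_mod_cast hn
  set P : ℝ → ℝ := fun r => 2 * r ^ n * deriv η (r ^ 2) with hP
  set g : ℝ → ℝ := fun r => 2 * n * deriv η (r ^ 2) + 4 * r ^ 2 * deriv (deriv η) (r ^ 2) with hg
  have hPd : ∀ r, HasDerivAt P (r ^ (n - 1) * g r) r := fun r => by
    have h1 : HasDerivAt (fun r : ℝ => deriv η (r ^ 2))
        (deriv (deriv η) (r ^ 2) * (2 * r)) r := by
      simpa using! ((hη'.differentiable (by simp)) (r ^ 2)).hasDerivAt.comp r (hasDerivAt_pow 2 r)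
    refine HasDerivAt.congr_deriv (f := P) (((hasDerivAt_pow n r).const_mul 2).mul h1) ?_
    obtain ⟨k, rfl⟩ : ∃ k, n = k + 1 := ⟨n - 1, by omega⟩
    simp only [hg, Nat.add_sub_cancel]
    ring
  have hPconst : ∀ r, 1 < r → P r = -((n : ℝ) - 2) := fun r hr => by
    have hr2 : 1 < r ^ 2 := by nlinarith
    have hev : η =ᶠ[𝓝 (r ^ 2)] fun s => s ^ (-(((n : ℝ) - 2) / 2)) := by
      filter_upwards [lt_mem_nhds hr2] with s hs using hη1 s hs.le
    simp only [hP]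
    rw [hev.deriv_eq, (Real.hasDerivAt_rpow_const (Or.inl (by positivity))).deriv,
      ← Real.rpow_natCast r 2, ← Real.rpow_mul (by linarith), ← Real.rpow_natCast r n]
    have : r ^ (n : ℝ) * r ^ (((2 : ℕ) : ℝ) * (-(((n : ℝ) - 2) / 2) - 1)) = 1 := by
      rw [← Real.rpow_add (by linarith),
        show (n : ℝ) + ((2 : ℕ) : ℝ) * (-(((n : ℝ) - 2) / 2) - 1) = 0 by push_cast; ring,
        Real.rpow_zero]
    linear_combination (-((n : ℝ) - 2)) * this
  have hg0 : ∀ r, 1 < r → g r = 0 := fun r hr => by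
    have hev : P =ᶠ[𝓝 r] fun _ => -((n : ℝ) - 2) := by
      filter_upwards [lt_mem_nhds hr] with s hs using hPconst s hs
    have h0 : r ^ (n - 1) * g r = 0 := by
      rw [← (hPd r).deriv, hev.deriv_eq, deriv_const]
    exact (mul_eq_zero.1 h0).resolve_left (by positivity)
  have hlap : ∀ y : EuclideanSpace ℝ (Fin n), lap (fun y => η (‖y‖ ^ 2)) y = g ‖y‖ :=
    fun y => lap_comp_norm_sq hη y
  refine ⟨fun y => η (‖y‖ ^ 2), hη.comp (contDiff_norm_sq ℝ),
    fun y hy => hη1 _ (one_le_pow₀ hy), ?_, ?_⟩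
  · refine HasCompactSupport.intro (isCompact_closedBall 0 1) fun y hy => ?_
    rw [hlap, hg0 _ (by simpa using hy)]
  · have : Nonempty (Fin n) := ⟨⟨0, by omega⟩⟩
    simp only [hlap]
    rw [integral_fun_norm_addHaar volume g, finrank_euclideanSpace_fin]
    have hcont : Continuous fun r : ℝ => r ^ (n - 1) * g r := by
      have := hη'.continuous
      have := (contDiff_infty_iff_deriv.1 hη').2.continuous
      fun_prop
    have hint : ∫ r in Set.Ioi (0 : ℝ), r ^ (n - 1) • g r = -((n : ℝ) - 2) := by
      have h2 : ∫ r in Set.Ioi (0 : ℝ), r ^ (n - 1) • g r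
          = ∫ r in Set.Ioc (0 : ℝ) 2, r ^ (n - 1) • g r := by
        refine (setIntegral_eq_of_subset_of_forall_sdiff_eq_zero measurableSet_Ioi
          Set.Ioc_subset_Ioi_self fun r hr => ?_)
        rw [hg0 r, smul_zero]
        have h0 : 0 < r := hr.1
        have : ¬ r ≤ 2 := fun h => hr.2 ⟨h0, h⟩
        linarith
      rw [h2, ← intervalIntegral.integral_of_le (by norm_num)]
      simp only [smul_eq_mul]
      rw [intervalIntegral.integral_eq_sub_of_hasDerivAt (fun r _ => hPd r)
        (hcont.intervalIntegrable _ _), hPconst 2 (by norm_num)]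
      simp [hP, show n ≠ 0 by omega]
    rw [hint]
    have hball : volume.real (ball (0 : EuclideanSpace ℝ (Fin n)) 1) ≠ 0 :=
      (ENNReal.toReal_pos (measure_ball_pos volume 0 one_pos).ne' measure_ball_lt_top.ne).ne'
    simp only [nsmul_eq_mul, smul_eq_mul]
    refine mul_ne_zero (by positivity) (mul_ne_zero hball ?_)
    linarith

theorem ContDiff.continuous_lap {u : EuclideanSpace ℝ (Fin n) → ℝ} (hu : ContDiff ℝ 2 u) :
    Continuous (lap u) := by
  have : lap u = fun y => ∑ i, _root_.dirDeriv (EuclideanSpace.single i 1)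
    (_root_.dirDeriv (EuclideanSpace.single i 1) u) y := rfl
  rw [this]
  exact continuous_finsetSum _ fun i _ =>
    ((hu.dirDeriv (m := 1) (k := 2) (by norm_num) _).dirDeriv (m := 0) (k := 1) (by simp) _).continuous

end Kernel

section Holder

open Metric Filter Topology
open scoped ContDiff

variable {E : Type*} [NormedAddCommGroup E] [NormedSpace ℝ E]
variable {G : Type*} [NormedAddCommGroup G] [NormedSpace ℝ G]

theorem Real.abs_rpow_sub_rpow_le {a b β : ℝ} (ha : 0 ≤ a) (hb : 0 ≤ b) (hβ0 : 0 ≤ β)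
    (hβ1 : β ≤ 1) : |a ^ β - b ^ β| ≤ |a - b| ^ β := by
  wlog h : b ≤ a generalizing a b
  · rw [abs_sub_comm, abs_sub_comm a b]
    exact this hb ha (le_of_not_ge h)
  have h1 := Real.rpow_add_le_add_rpow hb (sub_nonneg.2 h) hβ0 hβ1
  rw [add_sub_cancel] at h1
  rw [abs_of_nonneg (sub_nonneg.2 (Real.rpow_le_rpow hb h hβ0)), abs_of_nonneg (sub_nonneg.2 h)]
  linarith

theorem ContDiff.exists_lipschitz_closedBall [FiniteDimensional ℝ E] {F : E → G}
    (hF : ContDiff ℝ 1 F) (R : ℝ) :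
    ∃ K, 0 ≤ K ∧ ∀ x ∈ closedBall (0 : E) R, ∀ y ∈ closedBall (0 : E) R,
      ‖F x - F y‖ ≤ K * ‖x - y‖ := by
  obtain ⟨K, hK⟩ := (isCompact_closedBall (0 : E) R).exists_bound_of_continuousOn
    (hF.continuous_fderiv one_ne_zero).continuousOn
  refine ⟨max K 0, le_max_right _ _, fun x hx y hy => ?_⟩
  exact (convex_closedBall (0 : E) R).norm_image_sub_le_of_norm_fderiv_le
    (fun z _ => hF.differentiable one_ne_zero z) (fun z hz => (hK z hz).trans (le_max_left _ _)) hy hx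

theorem ContDiff.locHolder [FiniteDimensional ℝ E] {F : E → G} (hF : ContDiff ℝ 1 F) {β : ℝ}
    (hβ1 : β ≤ 1) : LocHolder β F := fun R => by
  obtain ⟨K, hK0, hK⟩ := hF.exists_lipschitz_closedBall R
  refine ⟨K * (2 * R) ^ (1 - β), fun x hx y hy => (hK x hx y hy).trans ?_⟩
  rcases eq_or_ne x y with rfl | hxy
  · rw [sub_self, norm_zero, mul_zero]
    have hR : 0 ≤ R := (norm_nonneg x).trans (by simpa using hx)
    positivity
  have hpos : 0 < ‖x - y‖ := norm_pos_iff.2 (sub_ne_zero.2 hxy)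
  have hle : ‖x - y‖ ≤ 2 * R := by
    have hx' : ‖x‖ ≤ R := by simpa using hx
    have hy' : ‖y‖ ≤ R := by simpa using hy
    linarith [norm_sub_le x y]
  rw [mul_assoc]
  refine mul_le_mul_of_nonneg_left ?_ hK0
  calc ‖x - y‖ = ‖x - y‖ ^ (1 - β) * ‖x - y‖ ^ β := by
        rw [← Real.rpow_add hpos, sub_add_cancel, Real.rpow_one]
    _ ≤ (2 * R) ^ (1 - β) * ‖x - y‖ ^ β := by
        gcongr

theorem LocHolder.smul [FiniteDimensional ℝ E] {a : E → ℝ} {F : E → G} {β : ℝ}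
    (ha : LocHolder β a) (hF : LocHolder β F) (hac : Continuous a) (hFc : Continuous F) :
    LocHolder β fun x => a x • F x := fun R => by
  obtain ⟨A, hA⟩ := (isCompact_closedBall (0 : E) R).exists_bound_of_continuousOn hac.continuousOn
  obtain ⟨B, hB⟩ := (isCompact_closedBall (0 : E) R).exists_bound_of_continuousOn hFc.continuousOn
  obtain ⟨C, hC⟩ := ha R
  obtain ⟨D, hD⟩ := hF R
  refine ⟨A * D + C * B, fun x hx y hy => ?_⟩
  calc ‖a x • F x - a y • F y‖ = ‖a x • (F x - F y) + (a x - a y) • F y‖ := by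
        congr 1; module
    _ ≤ ‖a x‖ * ‖F x - F y‖ + ‖a x - a y‖ * ‖F y‖ := by
        rw [← norm_smul, ← norm_smul]; exact norm_add_le _ _
    _ ≤ A * (D * ‖x - y‖ ^ β) + C * ‖x - y‖ ^ β * B := by
        gcongr
        · exact (norm_nonneg _).trans (hA x hx)
        · exact hA x hx
        · exact hD x hx y hy
        · exact (norm_nonneg _).trans (hC x hx y hy)
        · exact hC x hx y hy
        · exact hB y hy
    _ = _ := by ring

theorem locHolder_abs_rpow [FiniteDimensional ℝ E] {u : E → ℝ} (hu : ContDiff ℝ 1 u) {β : ℝ}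
    (hβ0 : 0 ≤ β) (hβ1 : β ≤ 1) : LocHolder β fun x => |u x| ^ β := fun R => by
  obtain ⟨K, hK0, hK⟩ := hu.exists_lipschitz_closedBall R
  refine ⟨K ^ β, fun x hx y hy => ?_⟩
  rw [← Real.mul_rpow hK0 (norm_nonneg _)]
  exact (Real.abs_rpow_sub_rpow_le (abs_nonneg _) (abs_nonneg _) hβ0 hβ1).trans
    (Real.rpow_le_rpow (abs_nonneg _) ((abs_abs_sub_abs_le _ _).trans (hK x hx y hy)) hβ0)

theorem hasDerivAt_abs_rpow_mul_self {q : ℝ} (hq : 0 < q) (t : ℝ) :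
    HasDerivAt (fun t : ℝ => |t| ^ q * t) ((q + 1) * |t| ^ q) t := by
  rcases lt_trichotomy t 0 with ht | rfl | ht
  · have h := (((hasDerivAt_neg t).rpow_const (p := q) (Or.inl (by linarith))).fun_mul
      (hasDerivAt_id t))
    have hev : (fun t : ℝ => |t| ^ q * t) =ᶠ[𝓝 t] fun t => (-t) ^ q * id t := by
      filter_upwards [gt_mem_nhds ht] with s hs
      rw [abs_of_neg hs, id]
    refine (h.congr_of_eventuallyEq hev).congr_deriv ?_
    have ht0 := ht.ne
    rw [abs_of_neg ht, Real.rpow_sub_one (by linarith)]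
    simp only [id]
    field_simp
  · rw [abs_zero, Real.zero_rpow hq.ne', mul_zero, hasDerivAt_iff_tendsto_slope_zero]
    have hc : Continuous fun t : ℝ => |t| ^ q := continuous_abs.rpow_const fun _ => Or.inr hq.le
    have h0 := (hc.tendsto 0).mono_left (nhdsWithin_le_nhds (s := {0}ᶜ))
    rw [abs_zero, Real.zero_rpow hq.ne'] at h0
    refine h0.congr' ?_
    filter_upwards [self_mem_nhdsWithin] with s hs
    have hs' : s ≠ 0 := hs
    simp only [zero_add, mul_zero, sub_zero, smul_eq_mul]
    field_simp
  · have h := (((hasDerivAt_id t).rpow_const (p := q) (Or.inl ht.ne')).fun_mul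
      (hasDerivAt_id t))
    have hev : (fun t : ℝ => |t| ^ q * t) =ᶠ[𝓝 t] fun t => id t ^ q * id t := by
      filter_upwards [lt_mem_nhds ht] with s hs
      rw [abs_of_pos hs, id]
    refine (h.congr_of_eventuallyEq hev).congr_deriv ?_
    rw [abs_of_pos ht]
    simp only [id]
    rw [Real.rpow_sub_one ht.ne']
    field_simp

end Holder

section Regularity

open MeasureTheory Metric Filter Topology
open scoped ContDiff

variable {n : ℕ}

theorem dilAvg_lap_left {ψ u : EuclideanSpace ℝ (Fin n) → ℝ} (hψ : ContDiff ℝ ∞ ψ)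
    (hc : HasCompactSupport ψ) (hu : ContDiff ℝ 2 u) (a b : EuclideanSpace ℝ (Fin n)) {r : ℝ}
    (hr : r ≠ 0) (x : EuclideanSpace ℝ (Fin n)) :
    dilAvg (lap ψ) (dirDeriv a (dirDeriv b u)) r x
      = dilAvg (dirDeriv a (dirDeriv b ψ)) (lap u) r x := by
  have hsm : ∀ {f : EuclideanSpace ℝ (Fin n) → ℝ}, ContDiff ℝ ∞ f → ∀ v,
      ContDiff ℝ ∞ (dirDeriv v f) := fun hf v => hf.dirDeriv (m := ⊤) (k := ⊤) (by simp) v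
  have h2 : ∀ {f : EuclideanSpace ℝ (Fin n) → ℝ}, ContDiff ℝ ∞ f → ContDiff ℝ 2 f :=
    fun hf => by exact_mod_cast contDiff_infty.1 hf 2
  have hcont : ∀ v w, Continuous (dirDeriv v (dirDeriv w u)) := fun v w =>
    ((hu.dirDeriv (m := 1) (k := 2) (by norm_num) w).dirDeriv (m := 0) (k := 1) (by simp) v).continuous
  set e : Fin n → EuclideanSpace ℝ (Fin n) := fun i => EuclideanSpace.single i 1
  have hleft : dilAvg (lap ψ) (dirDeriv a (dirDeriv b u)) r x
      = ∑ i, dilAvg (dirDeriv (e i) (dirDeriv (e i) ψ)) (dirDeriv a (dirDeriv b u)) r x := by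
    simp only [dilAvg]
    rw [← integral_finsetSum _ fun i _ => integrable_dilAvg (hsm (hsm hψ _) _).continuous
      ((hc.dirDeriv _).dirDeriv _) (hcont a b) r x]
    simp only [← Finset.sum_smul]
    rfl
  have hright : dilAvg (dirDeriv a (dirDeriv b ψ)) (lap u) r x
      = ∑ i, dilAvg (dirDeriv a (dirDeriv b ψ)) (dirDeriv (e i) (dirDeriv (e i) u)) r x := by
    simp only [dilAvg]
    rw [← integral_finsetSum _ fun i _ => integrable_dilAvg (hsm (hsm hψ _) _).continuous
      ((hc.dirDeriv _).dirDeriv _) (hcont _ _) r x]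
    simp only [← Finset.smul_sum]
    rfl
  rw [hleft, hright]
  refine Finset.sum_congr rfl fun i _ => mul_left_cancel₀ (pow_ne_zero 2 hr) ?_
  rw [← dilAvg_dirDeriv_dirDeriv_left (h2 (hsm (hsm hψ _) _)) ((hc.dirDeriv _).dirDeriv _) hu,
    ← dilAvg_dirDeriv_dirDeriv_left (h2 (hsm (hsm hψ _) _)) ((hc.dirDeriv _).dirDeriv _) hu,
    dirDeriv_comm (h2 (hsm hψ _)) b, dirDeriv_comm (h2 hψ) b,
    dirDeriv_comm (h2 (hsm (hsm hψ _) _)) a, dirDeriv_comm (h2 (hsm hψ _)) a]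

/-- The Laplacian of a smoothed fundamental solution has dyadic increments which are Laplacians of
a compactly supported function. -/
theorem dilAvg_lap_sub {N : EuclideanSpace ℝ (Fin n) → ℝ} (hn : 2 ≤ n) (hN : ContDiff ℝ 2 N)
    (hc : HasCompactSupport (lap N)) {w : EuclideanSpace ℝ (Fin n) → ℝ} (hw : Continuous w) (r : ℝ)
    (x : EuclideanSpace ℝ (Fin n)) :
    dilAvg (lap N) w (r / 2) x - dilAvg (lap N) w r x
      = dilAvg (lap fun y => 2 ^ (n - 2) * N ((2 : ℝ) • y) - N y) w r x := by
  have hlap : ∀ y, lap (fun y => 2 ^ (n - 2) * N ((2 : ℝ) • y) - N y) y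
      = 2 ^ n * lap N ((2 : ℝ) • y) - lap N y := fun y => by
    have hN2 : ContDiff ℝ 2 fun y => N ((2 : ℝ) • y) := hN.comp (contDiff_const_smul _)
    have hd : ∀ {f : EuclideanSpace ℝ (Fin n) → ℝ}, ContDiff ℝ 2 f → ∀ v,
        Differentiable ℝ (dirDeriv v f) := fun hf v =>
      (hf.dirDeriv (m := 1) (k := 2) (by norm_num) v).differentiable one_ne_zero
    have hsub : ∀ {f g : EuclideanSpace ℝ (Fin n) → ℝ} (c : ℝ), Differentiable ℝ f →
        Differentiable ℝ g → ∀ v, dirDeriv v (fun y => c * f y - g y)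
          = fun y => c * dirDeriv v f y - dirDeriv v g y := fun c hf hg v => by
      ext y
      simp only [dirDeriv]
      rw [fderiv_fun_sub ((hf y).const_mul c) (hg y), fderiv_const_mul (hf y)]
      simp
    have h4 : (2 : ℝ) ^ n = 2 ^ (n - 2) * 2 ^ 2 := by rw [← pow_add, Nat.sub_add_cancel hn]
    rw [h4, mul_assoc, ← lap_comp_smul hN, lap_eq_sum_dirDeriv, lap_eq_sum_dirDeriv,
      lap_eq_sum_dirDeriv, Finset.mul_sum, ← Finset.sum_sub_distrib]
    refine Finset.sum_congr rfl fun i _ => ?_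
    rw [hsub _ (hN2.differentiable (by norm_num)) (hN.differentiable (by norm_num)),
      hsub _ (hd hN2 _) (hd hN _)]
  have hscale : ∫ y, lap N ((2 : ℝ) • y) • w (x + r • y)
      = ((2 : ℝ) ^ n)⁻¹ * dilAvg (lap N) w (r / 2) x := by
    have := Measure.integral_comp_smul_of_nonneg (volume : Measure (EuclideanSpace ℝ (Fin n)))
      (fun y => lap N y • w (x + (r / 2) • y)) 2 (hR := by norm_num)
    simp only [smul_smul, finrank_euclideanSpace_fin] at this
    rw [div_mul_cancel₀ r two_ne_zero] at this
    rw [this, smul_eq_mul, dilAvg]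
  have hcont := hN.continuous_lap
  have hint2 : Integrable fun y => lap N ((2 : ℝ) • y) • w (x + r • y) :=
    integrable_dilAvg (ψ := fun y => lap N ((2 : ℝ) • y)) (by fun_prop)
      (hc.comp_homeomorph (Homeomorph.smulOfNeZero (2 : ℝ) two_ne_zero)) hw r x
  have hsplit : dilAvg (lap fun y => 2 ^ (n - 2) * N ((2 : ℝ) • y) - N y) w r x
      = 2 ^ n * (∫ y, lap N ((2 : ℝ) • y) • w (x + r • y)) - dilAvg (lap N) w r x := by
    rw [dilAvg, dilAvg, ← integral_const_mul,
      ← integral_sub (hint2.const_mul _) (integrable_dilAvg hcont hc hw r x)]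
    refine integral_congr_ae (ae_of_all _ fun y => ?_)
    simp only [hlap, smul_eq_mul]
    ring
  rw [hsplit, hscale, mul_inv_cancel_left₀ (by positivity)]

/-- Interior Schauder regularity: a `C²` function whose Laplacian is `C^{1,β}` has differentiable
second derivatives. -/
theorem differentiable_dirDeriv_dirDeriv_of_lap (hn : 3 ≤ n) {u : EuclideanSpace ℝ (Fin n) → ℝ}
    (hu : ContDiff ℝ 2 u) (hf : ContDiff ℝ 1 (lap u)) {β : ℝ} (hβ0 : 0 < β) (hβ1 : β ≤ 1)
    (hH : LocHolder β (fderiv ℝ (lap u))) (a b : EuclideanSpace ℝ (Fin n)) :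
    Differentiable ℝ (dirDeriv a (dirDeriv b u)) := by
  obtain ⟨N, hN, hN1, hNc, hN0⟩ := exists_smoothed_fundamental_solution hn
  have hsm : ∀ {f : EuclideanSpace ℝ (Fin n) → ℝ}, ContDiff ℝ ∞ f → ∀ v,
      ContDiff ℝ ∞ (dirDeriv v f) := fun hf v => hf.dirDeriv (m := ⊤) (k := ⊤) (by simp) v
  have hle : ∀ {k : ℕ}, ((k : ℕ∞) : WithTop ℕ∞) ≤ ∞ := by exact_mod_cast le_top
  set ψ : EuclideanSpace ℝ (Fin n) → ℝ := fun y => 2 ^ (n - 2) * N ((2 : ℝ) • y) - N y with hψ_def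
  have hψ : ContDiff ℝ ∞ ψ :=
    (contDiff_const.mul (hN.comp (contDiff_const_smul _))).sub hN
  have hψc : HasCompactSupport ψ := by
    refine HasCompactSupport.intro (isCompact_closedBall 0 1) fun y hy => ?_
    have hy1 : 1 < ‖y‖ := by simpa using hy
    have hn2 : (((n - 2 : ℕ) : ℕ) : ℝ) = (n : ℝ) - 2 := by
      rw [Nat.cast_sub (by omega)]; norm_num
    have h2 : ‖(2 : ℝ) • y‖ = 2 * ‖y‖ := by simp [norm_smul]
    have h4 : (2 : ℝ) ^ (n - 2) * (2 ^ 2) ^ (-(((n : ℝ) - 2) / 2)) = 1 := by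
      rw [← Real.rpow_natCast 2 (n - 2), ← Real.rpow_natCast 2 2, ← Real.rpow_mul (by norm_num),
        ← Real.rpow_add (by norm_num), hn2,
        show (n : ℝ) - 2 + ((2 : ℕ) : ℝ) * -(((n : ℝ) - 2) / 2) = 0 by push_cast; ring,
        Real.rpow_zero]
    simp only [hψ_def]
    rw [hN1 _ hy1.le, hN1 _ (by rw [h2]; linarith), h2, mul_pow,
      Real.mul_rpow (by norm_num) (by positivity), ← mul_assoc, h4, one_mul, sub_self]
  have hlapN : ContDiff ℝ 1 (lap N) := by
    refine ContDiff.sum (f := fun i : Fin n =>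
      dirDeriv (EuclideanSpace.single i 1) (dirDeriv (EuclideanSpace.single i 1) N)) fun i _ => ?_
    exact (hsm (hsm hN _) _).of_le hle
  have hθ0 : ∫ y, dirDeriv a (dirDeriv b ψ) y = 0 := by
    have := dilAvg_dirDeriv_left ((hsm hψ b).of_le hle) (hψc.dirDeriv b)
      (contDiff_const (c := (1 : ℝ))) a 0 0
    simpa [dilAvg] using this
  have hwc : Continuous (dirDeriv a (dirDeriv b u)) :=
    ((hu.dirDeriv (m := 1) (k := 2) (by norm_num) b).dirDeriv (m := 0) (k := 1) (by simp) a).continuous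
  refine differentiable_of_dilAvg_sub hβ0 hlapN hNc hN0 (hsm (hsm hψ b) a).continuous
    ((hψc.dirDeriv b).dirDeriv a) hθ0 hwc hf (hf.locHolder hβ1) hH fun r hr x => ?_
  rw [dilAvg_lap_sub (by omega) (by exact_mod_cast contDiff_infty.1 hN 2) hNc hwc,
    dilAvg_lap_left hψ hψc hu a b hr.ne']

end Regularity

section ProductRules

variable {E : Type*} [NormedAddCommGroup E] [NormedSpace ℝ E]

theorem dirDeriv_add {f g : E → ℝ} (hf : Differentiable ℝ f) (hg : Differentiable ℝ g) (v : E) :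
    dirDeriv v (fun y => f y + g y) = fun y => dirDeriv v f y + dirDeriv v g y := by
  ext y
  simp only [dirDeriv]
  rw [fderiv_fun_add (hf y) (hg y), add_apply]

theorem dirDeriv_mul {f g : E → ℝ} (hf : Differentiable ℝ f) (hg : Differentiable ℝ g) (v : E) :
    dirDeriv v (fun y => f y * g y) = fun y => dirDeriv v f y * g y + f y * dirDeriv v g y := by
  ext y
  simp only [dirDeriv]
  rw [fderiv_fun_mul (hf y) (hg y)]
  simp
  ring

theorem dirDeriv_const (c : ℝ) (v : E) : dirDeriv v (fun _ => c) = fun _ => 0 := by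
  ext y
  simp [dirDeriv]

theorem dirDeriv_sum {ι : Type*} [Fintype ι] {f : ι → E → ℝ} (hf : ∀ i, Differentiable ℝ (f i))
    (v : E) : dirDeriv v (fun y => ∑ i, f i y) = fun y => ∑ i, dirDeriv v (f i) y := by
  ext y
  simp only [dirDeriv]
  rw [fderiv_fun_sum fun i _ => hf i y, sum_apply]

theorem differentiable_of_clm_apply [FiniteDimensional ℝ E] {L : E → E →L[ℝ] ℝ}
    (h : ∀ v, Differentiable ℝ fun x => L x v) : Differentiable ℝ L := by
  let e₁ : E ≃L[ℝ] (Fin (Module.finrank ℝ E) → ℝ) :=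
    ContinuousLinearEquiv.ofFinrankEq (Module.finrank_fin_fun ℝ).symm
  let e₂ := (e₁.arrowCongr (1 : ℝ ≃L[ℝ] ℝ)).trans
    (ContinuousLinearEquiv.piRing (Fin (Module.finrank ℝ E)))
  rw [← Function.id_comp L, ← e₂.symm_comp_self]
  exact e₂.symm.differentiable.comp (differentiable_pi.2 fun i => h _)

/-- Differentiable functions whose first directional derivatives are differentiable. -/
def TwiceDifferentiable (f : E → ℝ) : Prop :=
  Differentiable ℝ f ∧ ∀ v, Differentiable ℝ (dirDeriv v f)

theorem ContDiff.twiceDifferentiable {f : E → ℝ} (hf : ContDiff ℝ 2 f) : TwiceDifferentiable f :=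
  ⟨hf.differentiable (by norm_num), fun v =>
    (hf.dirDeriv (m := 1) (k := 2) (by norm_num) v).differentiable one_ne_zero⟩

namespace TwiceDifferentiable

variable {f g : E → ℝ}

theorem add (hf : TwiceDifferentiable f) (hg : TwiceDifferentiable g) :
    TwiceDifferentiable fun y => f y + g y :=
  ⟨hf.1.add hg.1, fun v => by
    rw [dirDeriv_add hf.1 hg.1]
    exact (hf.2 v).add (hg.2 v)⟩

theorem mul (hf : TwiceDifferentiable f) (hg : TwiceDifferentiable g) :
    TwiceDifferentiable fun y => f y * g y :=
  ⟨hf.1.mul hg.1, fun v => by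
    rw [dirDeriv_mul hf.1 hg.1]
    exact ((hf.2 v).mul hg.1).add (hf.1.mul (hg.2 v))⟩

theorem sum {ι : Type*} [Fintype ι] {f : ι → E → ℝ} (hf : ∀ i, TwiceDifferentiable (f i)) :
    TwiceDifferentiable fun y => ∑ i, f i y :=
  ⟨Differentiable.fun_sum fun i _ => (hf i).1, fun v => by
    rw [dirDeriv_sum fun i => (hf i).1]
    exact Differentiable.fun_sum fun i _ => (hf i).2 v⟩

theorem dirDeriv_comm [FiniteDimensional ℝ E] (hf : TwiceDifferentiable f) (v w : E) :
    dirDeriv v (dirDeriv w f) = dirDeriv w (dirDeriv v f) :=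
  dirDeriv_comm_of_differentiable hf.1
    (differentiable_of_clm_apply hf.2) v w

end TwiceDifferentiable

end ProductRules

section Laplacian

open scoped ContDiff

variable {n : ℕ} {f g : EuclideanSpace ℝ (Fin n) → ℝ}

theorem lap_add (hf : TwiceDifferentiable f) (hg : TwiceDifferentiable g)
    (y : EuclideanSpace ℝ (Fin n)) : lap (fun y => f y + g y) y = lap f y + lap g y := by
  simp only [lap_eq_sum_dirDeriv, ← Finset.sum_add_distrib]
  refine Finset.sum_congr rfl fun i _ => ?_
  rw [dirDeriv_add hf.1 hg.1, dirDeriv_add (hf.2 _) (hg.2 _)]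

theorem lap_sum {ι : Type*} [Fintype ι] {f : ι → EuclideanSpace ℝ (Fin n) → ℝ}
    (hf : ∀ i, TwiceDifferentiable (f i)) (y : EuclideanSpace ℝ (Fin n)) :
    lap (fun y => ∑ i, f i y) y = ∑ i, lap (f i) y := by
  simp only [lap_eq_sum_dirDeriv]
  rw [Finset.sum_comm]
  refine Finset.sum_congr rfl fun i _ => ?_
  rw [dirDeriv_sum fun i => (hf i).1, dirDeriv_sum fun j => (hf j).2 _]

theorem lap_mul (hf : TwiceDifferentiable f) (hg : TwiceDifferentiable g)
    (y : EuclideanSpace ℝ (Fin n)) :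
    lap (fun y => f y * g y) y = lap f y * g y + f y * lap g y
      + 2 * ∑ i, dirDeriv (EuclideanSpace.single i 1) f y * dirDeriv (EuclideanSpace.single i 1) g y := by
  simp only [lap_eq_sum_dirDeriv, Finset.mul_sum, Finset.sum_mul, ← Finset.sum_add_distrib]
  refine Finset.sum_congr rfl fun i _ => ?_
  rw [dirDeriv_mul hf.1 hg.1, dirDeriv_add ((hf.2 _).fun_mul hg.1) (hf.1.fun_mul (hg.2 _)),
    dirDeriv_mul (hf.2 _) hg.1, dirDeriv_mul hf.1 (hg.2 _)]
  ring

theorem lap_const_mul (hf : TwiceDifferentiable f) (c : ℝ) (y : EuclideanSpace ℝ (Fin n)) :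
    lap (fun y => c * f y) y = c * lap f y := by
  rw [lap_mul (contDiff_const (c := c)).twiceDifferentiable hf]
  simp [lap_eq_sum_dirDeriv, dirDeriv_const]

theorem lap_dirDeriv (hf : TwiceDifferentiable f)
    (hf' : ∀ v, TwiceDifferentiable (dirDeriv v f)) (v y : EuclideanSpace ℝ (Fin n)) :
    lap (dirDeriv v f) y = dirDeriv v (lap f) y := by
  have h : lap f = fun y => ∑ i, dirDeriv (EuclideanSpace.single i 1)
      (dirDeriv (EuclideanSpace.single i 1) f) y := rfl
  rw [h, dirDeriv_sum fun i => (hf' _).2 _, lap_eq_sum_dirDeriv]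
  refine Finset.sum_congr rfl fun i _ => ?_
  rw [hf.dirDeriv_comm _ v, (hf' _).dirDeriv_comm _ v]

theorem fderiv_eq_sum_dirDeriv (y w : EuclideanSpace ℝ (Fin n)) :
    fderiv ℝ f y w = ∑ i, w i * dirDeriv (EuclideanSpace.single i 1) f y := by
  have hw : w = ∑ i, w i • EuclideanSpace.single i (1 : ℝ) := by
    simpa using ((EuclideanSpace.basisFun (Fin n) ℝ).sum_repr w).symm
  conv_lhs => rw [hw]
  simp [dirDeriv]

theorem contDiff_euclidean_coord (i : Fin n) (k : WithTop ℕ∞) :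
    ContDiff ℝ k fun y : EuclideanSpace ℝ (Fin n) => y i :=
  (EuclideanSpace.proj i : EuclideanSpace ℝ (Fin n) →L[ℝ] ℝ).contDiff

theorem dirDeriv_coord (v : EuclideanSpace ℝ (Fin n)) (i : Fin n) :
    dirDeriv v (fun y => y i) = fun _ => v i := by
  ext y
  exact congrArg (· v) (EuclideanSpace.proj i : EuclideanSpace ℝ (Fin n) →L[ℝ] ℝ).fderiv

theorem lap_coord_mul (hf : TwiceDifferentiable f) (i : Fin n) (y : EuclideanSpace ℝ (Fin n)) :
    lap (fun y => y i * f y) y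
      = y i * lap f y + 2 * dirDeriv (EuclideanSpace.single i 1) f y := by
  rw [lap_mul (contDiff_euclidean_coord i 2).twiceDifferentiable hf]
  simp [lap_eq_sum_dirDeriv, dirDeriv_coord, dirDeriv_const, PiLp.single_apply]

theorem lap_norm_sq_mul (hf : TwiceDifferentiable f) (y : EuclideanSpace ℝ (Fin n)) :
    lap (fun y => ‖y‖ ^ 2 * f y) y
      = ‖y‖ ^ 2 * lap f y + 4 * fderiv ℝ f y y + 2 * n * f y := by
  have hlap := lap_comp_norm_sq contDiff_id y
  have hd := fun v : EuclideanSpace ℝ (Fin n) => dirDeriv_comp_norm_sq differentiable_id v y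
  simp only [id] at hlap hd
  rw [lap_mul (contDiff_norm_sq ℝ).twiceDifferentiable hf, hlap, fderiv_eq_sum_dirDeriv]
  simp only [hd, Finset.mul_sum]
  simp [EuclideanSpace.inner_single_right, mul_assoc]
  have : ∀ a b c : ℝ, a = b → 2 * ((n : ℝ) * c) + ‖y‖ ^ 2 * lap f y + a
      = ‖y‖ ^ 2 * lap f y + b + 2 * (n * c) := fun a b c h => by rw [h]; ring
  refine this _ _ _ (Finset.sum_congr rfl fun i _ => by ring)

theorem twiceDifferentiable_euler (hf : ∀ v, TwiceDifferentiable (dirDeriv v f)) :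
    TwiceDifferentiable fun y => fderiv ℝ f y y := by
  simp only [fderiv_eq_sum_dirDeriv]
  exact .sum fun i => (contDiff_euclidean_coord i 2).twiceDifferentiable.mul (hf _)

theorem lap_euler (hf : TwiceDifferentiable f) (hf' : ∀ v, TwiceDifferentiable (dirDeriv v f))
    (y : EuclideanSpace ℝ (Fin n)) :
    lap (fun y => fderiv ℝ f y y) y = fderiv ℝ (lap f) y y + 2 * lap f y := by
  have h1 : (fun y => fderiv ℝ f y y)
      = fun y => ∑ i, y i * dirDeriv (EuclideanSpace.single i 1) f y := by
    ext y
    rw [fderiv_eq_sum_dirDeriv]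
  rw [h1, lap_sum fun i => (contDiff_euclidean_coord i 2).twiceDifferentiable.mul (hf' _),
    fderiv_eq_sum_dirDeriv, lap_eq_sum_dirDeriv f, Finset.mul_sum, ← Finset.sum_add_distrib]
  refine Finset.sum_congr rfl fun i _ => ?_
  rw [lap_coord_mul (hf' _), lap_dirDeriv hf hf']

theorem dirDeriv_euler (hf : TwiceDifferentiable f) (v y : EuclideanSpace ℝ (Fin n)) :
    dirDeriv v (fun y => fderiv ℝ f y y) y = dirDeriv v f y + fderiv ℝ (dirDeriv v f) y y := by
  have h1 : (fun y => fderiv ℝ f y y)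
      = fun y => ∑ i, y i * dirDeriv (EuclideanSpace.single i 1) f y := by
    ext y
    rw [fderiv_eq_sum_dirDeriv]
  rw [h1, dirDeriv_sum fun i => ((contDiff_euclidean_coord i 1).differentiable one_ne_zero).fun_mul
    (hf.2 _), fderiv_eq_sum_dirDeriv (f := dirDeriv v f)]
  rw [show dirDeriv v f y = fderiv ℝ f y v from rfl, fderiv_eq_sum_dirDeriv,
    ← Finset.sum_add_distrib]
  refine Finset.sum_congr rfl fun i _ => ?_
  rw [dirDeriv_mul ((contDiff_euclidean_coord i 1).differentiable one_ne_zero) (hf.2 _),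
    dirDeriv_coord, hf.dirDeriv_comm]

/-- The Laplacian of the infinitesimal special conformal transformation of `f`. -/
theorem lap_special_conformal (hf : TwiceDifferentiable f)
    (hf' : ∀ v, TwiceDifferentiable (dirDeriv v f)) (α : Fin n) (y : EuclideanSpace ℝ (Fin n)) :
    lap (fun z => -2 * z α * (((n : ℝ) - 2) / 2 * f z + fderiv ℝ f z z)
        + ‖z‖ ^ 2 * fderiv ℝ f z (EuclideanSpace.single α 1)) y
      = -2 * y α * (((n : ℝ) + 2) / 2 * lap f y + fderiv ℝ (lap f) y y)
        + ‖y‖ ^ 2 * fderiv ℝ (lap f) y (EuclideanSpace.single α 1) := by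
  set e : EuclideanSpace ℝ (Fin n) := EuclideanSpace.single α 1
  have hm : TwiceDifferentiable fun y => ((n : ℝ) - 2) / 2 * f y :=
    contDiff_const.twiceDifferentiable.mul hf
  have he := twiceDifferentiable_euler hf'
  have hs := hm.add he
  have hα := (contDiff_euclidean_coord α 2).twiceDifferentiable
  have hD : dirDeriv e (fun y => ((n : ℝ) - 2) / 2 * f y + fderiv ℝ f y y) y
      = (n : ℝ) / 2 * dirDeriv e f y + fderiv ℝ (dirDeriv e f) y y := by
    rw [dirDeriv_add hm.1 he.1]
    beta_reduce
    rw [dirDeriv_euler hf, dirDeriv_mul (differentiable_const _) hf.1,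
      dirDeriv_const]
    ring
  simp only [mul_assoc (-2 : ℝ)]
  change lap (fun z => -2 * (z α * (((n : ℝ) - 2) / 2 * f z + fderiv ℝ f z z))
    + ‖z‖ ^ 2 * dirDeriv e f z) y = _
  rw [lap_add (contDiff_const.twiceDifferentiable.mul (hα.mul hs))
      ((contDiff_norm_sq ℝ).twiceDifferentiable.mul (hf' e)),
    lap_const_mul (hα.mul hs), lap_coord_mul hs, lap_add hm he, lap_const_mul hf,
    lap_euler hf hf', hD, lap_norm_sq_mul (hf' e), lap_dirDeriv hf hf']
  simp only [dirDeriv]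
  ring

end Laplacian

/-- The Kelvin/special-conformal kernel element
`z = -2y_α(((n-2)/2)u + ∇u·y) + |y|² ∂_α u` solves the linearized equation
around any solution `u` of the critical Yamabe problem. -/
theorem kelvin_kernel_element (n : ℕ) (hn : 3 ≤ n)
    (u : EuclideanSpace ℝ (Fin n) → ℝ) (hu : ContDiff ℝ 2 u)
    (p γ : ℝ) (hp : p = ((n : ℝ) + 2) / ((n : ℝ) - 2))
    (hγ : γ = (n : ℝ) * ((n : ℝ) - 2) / 4)
    (hsol : ∀ y, -lap u y = γ * |u y| ^ (p - 1) * u y)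
    (α : Fin n) :
    ∀ y : EuclideanSpace ℝ (Fin n),
      lap (fun z => -2 * z α * (((n : ℝ) - 2) / 2 * u z + fderiv ℝ u z z)
          + ‖z‖ ^ 2 * fderiv ℝ u z (EuclideanSpace.single α 1)) y
        + p * γ * |u y| ^ (p - 1)
            * (-2 * y α * (((n : ℝ) - 2) / 2 * u y + fderiv ℝ u y y)
              + ‖y‖ ^ 2 * fderiv ℝ u y (EuclideanSpace.single α 1)) = 0 := by
  intro y
  have hn' : (1 : ℝ) ≤ n - 2 := by
    have : (3 : ℝ) ≤ n := by exact_mod_cast hn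
    linarith
  have hpm : p * (((n : ℝ) - 2) / 2) = ((n : ℝ) + 2) / 2 := by
    rw [hp]
    field_simp
  have hq : p - 1 = 1 / ((n : ℝ) - 2) * (4 : ℕ) := by
    rw [hp]
    field_simp
    push_cast
    ring
  have hq0 : 0 < p - 1 := by
    rw [hq]
    positivity
  have hβ0 : 0 < 1 / ((n : ℝ) - 2) := by positivity
  have hβ1 : 1 / ((n : ℝ) - 2) ≤ 1 := by
    rw [div_le_one (by linarith)]
    exact hn'
  have hu1 : ContDiff ℝ 1 u := hu.of_le (by norm_num)
  have hlap : lap u = fun y => -γ * (|u y| ^ (p - 1) * u y) := by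
    ext y
    linear_combination -hsol y
  have hlap' : ∀ y, HasFDerivAt (lap u) ((-γ * p * |u y| ^ (p - 1)) • fderiv ℝ u y) y := fun y => by
    rw [hlap]
    have h := ((hasDerivAt_abs_rpow_mul_self hq0 (u y)).comp_hasFDerivAt y
      (hu1.differentiable one_ne_zero y).hasFDerivAt).const_mul (-γ)
    refine h.congr_fderiv ?_
    rw [smul_smul, sub_add_cancel, mul_assoc]
  have hlapf : fderiv ℝ (lap u) = fun y => (-γ * p * |u y| ^ (p - 1)) • fderiv ℝ u y :=
    funext fun y => (hlap' y).fderiv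
  have hpow : Continuous fun y => |u y| ^ (p - 1) :=
    hu1.continuous.abs.rpow_const fun _ => Or.inr hq0.le
  have hu' : ContDiff ℝ 1 (fderiv ℝ u) := hu.fderiv_right (by norm_num)
  have hlap1 : ContDiff ℝ 1 (lap u) := by
    rw [contDiff_one_iff_fderiv, hlapf]
    exact ⟨fun y => (hlap' y).differentiableAt, (hpow.const_mul _).smul hu'.continuous⟩
  have hH : LocHolder (1 / ((n : ℝ) - 2)) (fderiv ℝ (lap u)) := by
    have hb := locHolder_abs_rpow hu1 hβ0.le hβ1
    have hbc : Continuous fun y => |u y| ^ (1 / ((n : ℝ) - 2)) :=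
      hu1.continuous.abs.rpow_const fun _ => Or.inr hβ0.le
    have hconst : LocHolder (1 / ((n : ℝ) - 2)) fun _ : EuclideanSpace ℝ (Fin n) => -γ * p :=
      (contDiff_const (c := -γ * p)).locHolder hβ1
    have h2 := hb.smul hb hbc hbc
    have h4 := h2.smul h2 (hbc.mul hbc) (hbc.mul hbc)
    have h := (hconst.smul h4 continuous_const ((hbc.mul hbc).mul (hbc.mul hbc))).smul
      (hu'.locHolder hβ1) (continuous_const.mul ((hbc.mul hbc).mul (hbc.mul hbc))) hu'.continuous
    have hfun : fderiv ℝ (lap u) = _ := hlapf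
    rw [hfun]
    convert h using 4 with y
    rw [hq, Real.rpow_mul (abs_nonneg _), Real.rpow_natCast, smul_eq_mul, smul_eq_mul, smul_eq_mul]
    ring
  have htd : ∀ v, TwiceDifferentiable (dirDeriv v u) := fun v =>
    ⟨hu.twiceDifferentiable.2 v, fun a =>
      differentiable_dirDeriv_dirDeriv_of_lap hn hu hlap1 hβ0 hβ1 hH a v⟩
  rw [lap_special_conformal hu.twiceDifferentiable htd, hlapf, hlap]
  simp only [smul_apply, smul_eq_mul]
  linear_combination 2 * y α * γ * |u y| ^ (p - 1) * u y * (-hpm)
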